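/- Uniform bound on the concentrated kinetic energy: assume δ ∈ (0, δ0/2) is such that for every λ > 0, every maximizer and every i ∈ {1,…,p}, sgn(κ_i)(ψ^λ + Σ_{j=p+1}^k κ_jG(x_j^λ,·)) ≤ c_i^λ everywhere on ∂B_{δ0}(x̄_i). Then there exist C > 0 and λ1 > 0 such that for every λ ≥ λ1 and every maximizer (ω^λ, x_{p+1}^λ, …, x_k^λ), the quantity T^λ := Σ_{i=1}^p (sgn(κ_i)/2)∫_D ω_i^λ(x)·[sgn(κ_i)(ψ^λ(x) + Σ_{j=p+1}^k κ_jG(x_j^λ,x)) − c_i^λ] dx satisfies T^λ ≤ C. -/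

import Mathlib

open MeasureTheory Metric Real Filter Topology

noncomputable section

abbrev E2 := EuclideanSpace ℝ (Fin 2)

/-- The potential of the density `b` with respect to the kernel `k`. -/
def pot (k : E2 → E2 → ℝ) (b : E2 → ℝ) (x : E2) : ℝ := ∫ y, k x y * b y

/-- The mutual energy of two densities with respect to the kernel `k`. -/
def mutualEnergy (k : E2 → E2 → ℝ) (a b : E2 → ℝ) : ℝ := ∫ x, a x * pot k b x

/-- Measurable, essentially bounded functions vanishing outside `K`. -/
def BddDensity (K : Set E2) (f : E2 → ℝ) : Prop :=
  Measurable f ∧ (∀ x, x ∉ K → f x = 0) ∧ ∃ B, ∀ᵐ x : E2, |f x| ≤ B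

/-- Kernels which are integrable on `K × K` and whose sections at points of `K` are integrable
on `K`. -/
def IntegrableKernel (K : Set E2) (k : E2 → E2 → ℝ) : Prop :=
  IntegrableOn (fun q : E2 × E2 => k q.1 q.2) (K ×ˢ K) ∧ ∀ x ∈ K, IntegrableOn (k x) K

/-- The logarithmic kernel of the plane, without its normalizing constant. -/
def logKernel (x y : E2) : ℝ := Real.log (1 / dist x y)

/-- The truncated logarithmic singularity `max (log (1 / ‖z‖)) 0`. -/
def logCore (z : E2) : ℝ := posLog ‖z‖⁻¹

section Density

variable {K : Set E2} {k k' : E2 → E2 → ℝ} {a b c : E2 → ℝ}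

theorem BddDensity.add (ha : BddDensity K a) (hb : BddDensity K b) : BddDensity K (a + b) := by
  obtain ⟨h1, h2, A, h3⟩ := ha
  obtain ⟨h1', h2', B, h3'⟩ := hb
  refine ⟨h1.add h1', fun x hx => by simp [h2 x hx, h2' x hx], A + B, ?_⟩
  filter_upwards [h3, h3'] with x hx hx'
  exact (abs_add_le _ _).trans (add_le_add hx hx')

theorem BddDensity.smul (t : ℝ) (ha : BddDensity K a) : BddDensity K (t • a) := by
  obtain ⟨h1, h2, A, h3⟩ := ha
  refine ⟨h1.const_smul t, fun x hx => by simp [h2 x hx], |t| * A, ?_⟩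
  filter_upwards [h3] with x hx
  simpa [abs_mul] using mul_le_mul_of_nonneg_left hx (abs_nonneg t)

theorem BddDensity.zero : BddDensity K 0 :=
  ⟨measurable_zero, fun _ _ => rfl, 0, by simp⟩

theorem BddDensity.sum {ι : Type*} (s : Finset ι) {f : ι → E2 → ℝ}
    (hf : ∀ i ∈ s, BddDensity K (f i)) : BddDensity K (∑ i ∈ s, f i) := by
  classical
  induction s using Finset.induction_on with
  | empty => simpa using BddDensity.zero
  | insert i s hi ih =>
    rw [Finset.sum_insert hi]
    exact (hf i (Finset.mem_insert_self _ _)).add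
      (ih fun j hj => hf j (Finset.mem_insert_of_mem hj))

theorem BddDensity.mono {K' : Set E2} (hK : K ⊆ K') (ha : BddDensity K a) : BddDensity K' a :=
  ⟨ha.1, fun x hx => ha.2.1 x fun h => hx (hK h), ha.2.2⟩

theorem BddDensity.integrable_mul (hK : MeasurableSet K) {g : E2 → ℝ} (hg : IntegrableOn g K)
    (ha : BddDensity K a) : Integrable fun x => g x * a x := by
  obtain ⟨h1, h2, A, h3⟩ := ha
  have h := ((integrable_indicator_iff hK).2 hg).mul_bdd h1.aestronglyMeasurable (by simpa using h3)
  refine h.congr (.of_forall fun x => ?_)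
  by_cases hx : x ∈ K
  · simp [hx]
  · simp [h2 x hx]

theorem BddDensity.integrable (hK : IsCompact K) (ha : BddDensity K a) : Integrable a := by
  have h := ha.integrable_mul (g := fun _ => 1) hK.measurableSet
    (integrableOn_const hK.measure_lt_top.ne)
  simpa using h

theorem integrable_kernel_mul_mul (hK : MeasurableSet K) (hk : IntegrableKernel K k)
    (ha : BddDensity K a) (hb : BddDensity K b) :
    Integrable fun q : E2 × E2 => k q.1 q.2 * a q.1 * b q.2 := by
  obtain ⟨h1, h2, A, h3⟩ := ha
  obtain ⟨h1', h2', B, h3'⟩ := hb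
  have hA : ∀ᵐ q : E2 × E2, |a q.1| ≤ A := Measure.quasiMeasurePreserving_fst.ae h3
  have hB : ∀ᵐ q : E2 × E2, |b q.2| ≤ B := Measure.quasiMeasurePreserving_snd.ae h3'
  have h := (((integrable_indicator_iff (hK.prod hK)).2 hk.1).mul_bdd
    (h1.comp measurable_fst).aestronglyMeasurable (by simpa using hA)).mul_bdd
    (h1'.comp measurable_snd).aestronglyMeasurable (by simpa using hB)
  refine h.congr (.of_forall fun q => ?_)
  by_cases hq : q ∈ K ×ˢ K
  · simp only [Set.indicator_of_mem hq, Function.comp]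
  · simp only [Set.indicator_of_notMem hq, Function.comp]
    by_cases hq1 : q.1 ∈ K
    · rw [h2' q.2 fun hq2 => hq ⟨hq1, hq2⟩]; simp
    · rw [h2 q.1 hq1]; simp

theorem mutualEnergy_eq_integral_integral :
    mutualEnergy k a b = ∫ x, ∫ y, k x y * a x * b y := by
  simp only [mutualEnergy, pot, ← integral_const_mul]
  congr! 4
  ring

theorem integrable_mul_pot (hK : MeasurableSet K) (hk : IntegrableKernel K k)
    (ha : BddDensity K a) (hb : BddDensity K b) : Integrable fun x => a x * pot k b x := by
  have h := (integrable_kernel_mul_mul hK hk ha hb).integral_prod_left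
  refine h.congr (.of_forall fun x => ?_)
  simp only [pot, ← integral_const_mul]
  congr! 2
  ring

theorem integrable_kernel_mul (hK : MeasurableSet K) (hk : IntegrableKernel K k)
    (hb : BddDensity K b) {x : E2} (hx : x ∈ K) : Integrable fun y => k x y * b y :=
  hb.integrable_mul hK (hk.2 x hx)

theorem integrableOn_pot (hK : IsCompact K) (hk : IntegrableKernel K k) (hb : BddDensity K b) :
    IntegrableOn (pot k b) K := by
  have hone : BddDensity K (K.indicator 1) := by
    refine ⟨measurable_one.indicator hK.measurableSet, fun x hx => by simp [hx], 1,
      .of_forall fun x => ?_⟩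
    by_cases hx : x ∈ K <;> simp [hx]
  rw [← integrable_indicator_iff hK.measurableSet]
  refine (integrable_mul_pot hK.measurableSet hk hone hb).congr (.of_forall fun x => ?_)
  by_cases hx : x ∈ K <;> simp [hx]

theorem pot_add (hK : MeasurableSet K) (hk : IntegrableKernel K k)
    (ha : BddDensity K a) (hb : BddDensity K b) {x : E2} (hx : x ∈ K) :
    pot k (a + b) x = pot k a x + pot k b x := by
  simp only [pot, Pi.add_apply, mul_add]
  exact integral_add (integrable_kernel_mul hK hk ha hx) (integrable_kernel_mul hK hk hb hx)

theorem pot_smul (t : ℝ) (x : E2) : pot k (t • b) x = t * pot k b x := by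
  simp only [pot, Pi.smul_apply, smul_eq_mul, ← integral_const_mul]
  congr! 2
  ring

theorem pot_sum {ι : Type*} (s : Finset ι) (hK : MeasurableSet K) (hk : IntegrableKernel K k)
    {f : ι → E2 → ℝ} (hf : ∀ i ∈ s, BddDensity K (f i)) {x : E2} (hx : x ∈ K) :
    pot k (∑ i ∈ s, f i) x = ∑ i ∈ s, pot k (f i) x := by
  simp only [pot, Finset.sum_apply, Finset.mul_sum]
  exact integral_finsetSum _ fun i hi => integrable_kernel_mul hK hk (hf i hi) hx

theorem mutualEnergy_add_right (hK : MeasurableSet K) (hk : IntegrableKernel K k)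
    (ha : BddDensity K a) (hb : BddDensity K b) (hc : BddDensity K c) :
    mutualEnergy k a (b + c) = mutualEnergy k a b + mutualEnergy k a c := by
  rw [mutualEnergy, mutualEnergy, mutualEnergy,
    ← integral_add (integrable_mul_pot hK hk ha hb) (integrable_mul_pot hK hk ha hc)]
  refine integral_congr_ae (.of_forall fun x => ?_)
  by_cases hx : x ∈ K
  · simp only [pot_add hK hk hb hc hx]; ring
  · simp [ha.2.1 x hx]

theorem mutualEnergy_smul_right (t : ℝ) :
    mutualEnergy k a (t • b) = t * mutualEnergy k a b := by
  simp only [mutualEnergy, pot_smul, ← integral_const_mul]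
  congr! 2
  ring

theorem mutualEnergy_comm (hK : MeasurableSet K) (hk : IntegrableKernel K k)
    (hsymm : ∀ x ∈ K, ∀ y ∈ K, k x y = k y x) (ha : BddDensity K a) (hb : BddDensity K b) :
    mutualEnergy k a b = mutualEnergy k b a := by
  rw [mutualEnergy_eq_integral_integral, mutualEnergy_eq_integral_integral,
    integral_integral_swap (integrable_kernel_mul_mul hK hk ha hb)]
  refine integral_congr_ae (.of_forall fun y => integral_congr_ae (.of_forall fun x => ?_))
  by_cases hx : x ∈ K
  · by_cases hy : y ∈ K
    · simp only [hsymm x hx y hy]; ring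
    · simp [hb.2.1 y hy]
  · simp [ha.2.1 x hx]

theorem mutualEnergy_add_smul (hK : MeasurableSet K) (hk : IntegrableKernel K k)
    (hsymm : ∀ x ∈ K, ∀ y ∈ K, k x y = k y x) (ha : BddDensity K a) (hb : BddDensity K b)
    (t : ℝ) :
    mutualEnergy k (a + t • b) (a + t • b) =
      mutualEnergy k a a + 2 * t * mutualEnergy k b a + t ^ 2 * mutualEnergy k b b := by
  have hab := ha.add (hb.smul t)
  rw [mutualEnergy_add_right hK hk hab ha (hb.smul t), mutualEnergy_smul_right,
    mutualEnergy_comm hK hk hsymm hab ha, mutualEnergy_comm hK hk hsymm hab hb,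
    mutualEnergy_add_right hK hk ha ha (hb.smul t),
    mutualEnergy_add_right hK hk hb ha (hb.smul t), mutualEnergy_smul_right,
    mutualEnergy_smul_right, mutualEnergy_comm hK hk hsymm ha hb]
  ring

theorem abs_pot_le {M : ℝ} {x : E2} (hb : Integrable b)
    (hM : ∀ y, b y ≠ 0 → |k x y| ≤ M) : |pot k b x| ≤ M * ∫ y, |b y| := by
  rw [← integral_const_mul, ← Real.norm_eq_abs]
  refine norm_integral_le_of_norm_le (hb.abs.const_mul M) (.of_forall fun y => ?_)
  by_cases hy : b y = 0
  · simp [hy]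
  · rw [norm_mul]
    exact mul_le_mul_of_nonneg_right (hM y hy) (abs_nonneg _)

end Density

section LogKernel

theorem logCore_nonneg (z : E2) : 0 ≤ logCore z := posLog_nonneg

theorem integrable_logCore : Integrable logCore := by
  have h : Integrable (fun z : E2 => (fun r : ℝ => posLog r⁻¹) ‖z‖) := by
    rw [integrable_fun_norm_addHaar volume (f := fun r : ℝ => posLog r⁻¹)]
    have hcont : ContinuousOn (fun r : ℝ => -(r * Real.log r)) (Set.Icc 0 1) :=
      Real.continuous_mul_log.neg.continuousOn
    have hI : IntegrableOn (fun r : ℝ => -(r * Real.log r)) (Set.Ioc 0 1) :=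
      (hcont.integrableOn_compact isCompact_Icc).mono_set Set.Ioc_subset_Icc_self
    rw [← integrable_indicator_iff measurableSet_Ioi]
    refine ((integrable_indicator_iff measurableSet_Ioc).2 hI).congr (.of_forall fun r => ?_)
    by_cases h0 : 0 < r
    · by_cases h1 : r ≤ 1
      · have hr : 1 ≤ |r⁻¹| := by
          rw [abs_of_pos (inv_pos.2 h0)]
          exact (one_le_inv₀ h0).2 h1
        simp [h0, h1, posLog_eq_log hr]
      · have hr : |r⁻¹| ≤ 1 := by
          rw [abs_of_pos (inv_pos.2 h0)]
          exact inv_le_one_of_one_le₀ (not_le.1 h1).le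
        simp [h0, h1, (posLog_eq_zero_iff _).2 hr]
    · simp [h0]
  exact h

theorem logKernel_eq (x y : E2) : logKernel x y = logCore (x - y) - posLog ‖x - y‖ := by
  have h := posLog_sub_posLog_inv (x := ‖x - y‖⁻¹)
  rw [inv_inv] at h
  rw [logKernel, logCore, h, dist_eq_norm, one_div]

theorem logKernel_comm (x y : E2) : logKernel x y = logKernel y x := by
  rw [logKernel, logKernel, dist_comm]

theorem integrableKernel_logKernel {K : Set E2} (hK : IsCompact K) :
    IntegrableKernel K logKernel := by
  have hfun : (fun q : E2 × E2 => logKernel q.1 q.2) =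
      fun q => logCore (q.1 - q.2) - posLog ‖q.1 - q.2‖ := by
    ext q; exact logKernel_eq _ _
  constructor
  · rw [hfun]
    refine Integrable.sub ?_ ?_
    · have hone : Integrable (K.indicator (fun _ => (1 : ℝ)) : E2 → ℝ) :=
        (integrable_indicator_iff hK.measurableSet).2 (integrableOn_const hK.measure_lt_top.ne)
      have h := (hone.convolution_integrand (ContinuousLinearMap.mul ℝ ℝ) integrable_logCore)
      refine (h.integrableOn (s := K ×ˢ K)).congr_fun (fun q hq => ?_)
        (hK.measurableSet.prod hK.measurableSet)
      simp [hq.2]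
    · refine ContinuousOn.integrableOn_compact (hK.prod hK) (Continuous.continuousOn ?_)
      fun_prop
  · intro x _
    have hx : logKernel x = fun y => logCore (x - y) - posLog ‖x - y‖ := by
      ext y; exact logKernel_eq _ _
    rw [hx]
    refine Integrable.sub (integrable_logCore.comp_sub_left x).integrableOn ?_
    refine ContinuousOn.integrableOn_compact hK (Continuous.continuousOn ?_)
    fun_prop

theorem integrable_logCore_scaled {ε : ℝ} (hε : 0 < ε) (x : E2) :
    Integrable fun y => logCore (ε⁻¹ • (x - y)) :=
  (integrable_logCore.comp_smul (inv_ne_zero hε.ne')).comp_sub_left x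

theorem integral_logCore_scaled {ε : ℝ} (hε : 0 < ε) (x : E2) :
    ∫ y, logCore (ε⁻¹ • (x - y)) = ε ^ 2 * ∫ z, logCore z := by
  rw [integral_sub_left_eq_self (fun z => logCore (ε⁻¹ • z)) volume x,
    Measure.integral_comp_inv_smul_of_nonneg _ _ hε.le]
  simp

theorem logKernel_le {ε : ℝ} (hε : 0 < ε) {x y : E2} (hxy : x ≠ y) :
    logKernel x y ≤ Real.log (1 / ε) + logCore (ε⁻¹ • (x - y)) := by
  have hd : 0 < ‖x - y‖ := norm_pos_iff.2 (sub_ne_zero.2 hxy)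
  have h : Real.log (ε * ‖x - y‖⁻¹) ≤ logCore (ε⁻¹ • (x - y)) := by
    rw [logCore, norm_smul, norm_inv, Real.norm_of_nonneg hε.le, mul_inv, inv_inv]
    exact le_max_right _ _
  rw [Real.log_mul hε.ne' (inv_ne_zero hd.ne')] at h
  rw [logKernel, dist_eq_norm, one_div, one_div, Real.log_inv ε]
  linarith

theorem logKernel_sub_le {ε : ℝ} (hε : 0 < ε) {x x₁ y : E2} (hx : dist x x₁ ≤ 4 * ε)
    (hxy : x ≠ y) (hxy₁ : x₁ ≠ y) :
    logKernel x₁ y - Real.log 5 - logCore (ε⁻¹ • (x₁ - y)) ≤ logKernel x y := by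
  have hd : 0 < dist x y := dist_pos.2 hxy
  have hd₁ : 0 < dist x₁ y := dist_pos.2 hxy₁
  have htri : dist x y ≤ 4 * ε + dist x₁ y := (dist_triangle x x₁ y).trans (by linarith)
  have hc : logCore (ε⁻¹ • (x₁ - y)) = max 0 (Real.log ε - Real.log (dist x₁ y)) := by
    rw [logCore, norm_smul, norm_inv, Real.norm_of_nonneg hε.le, mul_inv, inv_inv, posLog_apply,
      ← dist_eq_norm, Real.log_mul hε.ne' (inv_ne_zero hd₁.ne'), Real.log_inv, sub_eq_add_neg]
  rw [hc, logKernel, logKernel, one_div, one_div, Real.log_inv, Real.log_inv]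
  rcases le_total ε (dist x₁ y) with hle | hle
  · have h1 : Real.log (dist x y) ≤ Real.log (5 * dist x₁ y) :=
      Real.log_le_log hd (by linarith)
    rw [Real.log_mul (by norm_num) hd₁.ne'] at h1
    have := le_max_left 0 (Real.log ε - Real.log (dist x₁ y))
    linarith
  · have h1 : Real.log (dist x y) ≤ Real.log (5 * ε) :=
      Real.log_le_log hd (by linarith)
    rw [Real.log_mul (by norm_num) hε.ne'] at h1
    have := le_max_right 0 (Real.log ε - Real.log (dist x₁ y))
    linarith

variable {K : Set E2} {μ : E2 → ℝ} {lam m ε : ℝ}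

theorem integrable_logCore_scaled_mul (hε : 0 < ε) (x : E2) (hμ : BddDensity K μ) :
    Integrable fun y => logCore (ε⁻¹ • (x - y)) * μ y := by
  obtain ⟨B, hB⟩ := hμ.2.2
  exact (integrable_logCore_scaled hε x).mul_bdd hμ.1.aestronglyMeasurable (by simpa using hB)

theorem integral_logCore_scaled_mul_le (hε : 0 < ε) (x : E2) (hμ : BddDensity K μ)
    (hle : ∀ᵐ x, μ x ≤ lam) :
    ∫ y, logCore (ε⁻¹ • (x - y)) * μ y ≤ lam * ε ^ 2 * ∫ z, logCore z := by
  rw [mul_assoc, ← integral_logCore_scaled hε x, ← integral_const_mul]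
  refine integral_mono_ae (integrable_logCore_scaled_mul hε x hμ)
    ((integrable_logCore_scaled hε x).const_mul lam) ?_
  filter_upwards [hle] with y hy
  rw [mul_comm]
  exact mul_le_mul_of_nonneg_right hy (logCore_nonneg _)

theorem pot_logKernel_le (hK : IsCompact K) (hμ : BddDensity K μ) (h0 : ∀ᵐ x, 0 ≤ μ x)
    (hle : ∀ᵐ x, μ x ≤ lam) (hm : ∫ x, μ x = m) (hε : 0 < ε) {x : E2} (hx : x ∈ K) :
    pot logKernel μ x ≤ m * Real.log (1 / ε) + lam * ε ^ 2 * ∫ z, logCore z := by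
  have h1 : pot logKernel μ x ≤
      ∫ y, (Real.log (1 / ε) * μ y + logCore (ε⁻¹ • (x - y)) * μ y) := by
    refine integral_mono_ae
      (integrable_kernel_mul hK.measurableSet (integrableKernel_logKernel hK) hμ hx)
      (((hμ.integrable hK).const_mul _).add (integrable_logCore_scaled_mul hε x hμ)) ?_
    filter_upwards [h0, Measure.ae_ne volume x] with y hy hxy
    simp only [← add_mul]
    exact mul_le_mul_of_nonneg_right (logKernel_le hε hxy.symm) hy
  rw [integral_add ((hμ.integrable hK).const_mul _) (integrable_logCore_scaled_mul hε x hμ),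
    integral_const_mul, hm] at h1
  have := integral_logCore_scaled_mul_le hε x hμ hle
  linarith

theorem pot_logKernel_nearby (hK : IsCompact K) (hμ : BddDensity K μ) (h0 : ∀ᵐ x, 0 ≤ μ x)
    (hle : ∀ᵐ x, μ x ≤ lam) (hm : ∫ x, μ x = m) (hε : 0 < ε) {x x₁ : E2} (hx : x ∈ K)
    (hx₁ : x₁ ∈ K) (hd : dist x x₁ ≤ 4 * ε) :
    pot logKernel μ x₁ - m * Real.log 5 - lam * ε ^ 2 * ∫ z, logCore z ≤ pot logKernel μ x := by
  have hi := integrable_kernel_mul hK.measurableSet (integrableKernel_logKernel hK) hμ hx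
  have hi₁ := integrable_kernel_mul hK.measurableSet (integrableKernel_logKernel hK) hμ hx₁
  have hi₂ := (hμ.integrable hK).const_mul (Real.log 5)
  have hi₁₂ : Integrable fun y => logKernel x₁ y * μ y - Real.log 5 * μ y := hi₁.sub hi₂
  have hi₃ := integrable_logCore_scaled_mul hε x₁ hμ
  have h1 : ∫ y, (logKernel x₁ y * μ y - Real.log 5 * μ y - logCore (ε⁻¹ • (x₁ - y)) * μ y) ≤
      pot logKernel μ x := by
    refine integral_mono_ae (hi₁₂.sub hi₃) hi ?_
    filter_upwards [h0, Measure.ae_ne volume x, Measure.ae_ne volume x₁] with y hy hxy hxy₁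
    simp only [← sub_mul]
    exact mul_le_mul_of_nonneg_right (logKernel_sub_le hε hd hxy.symm hxy₁.symm) hy
  have h2 : ∫ y, (logKernel x₁ y * μ y - Real.log 5 * μ y - logCore (ε⁻¹ • (x₁ - y)) * μ y) =
      pot logKernel μ x₁ - m * Real.log 5 - ∫ y, logCore (ε⁻¹ • (x₁ - y)) * μ y := by
    rw [integral_sub hi₁₂ hi₃, integral_sub hi₁ hi₂, integral_const_mul, hm, pot]
    ring
  have := integral_logCore_scaled_mul_le hε x₁ hμ hle
  linarith

/-- The logarithmic energy of a density concentrated in a disc of radius `ε`. -/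
theorem mutualEnergy_logKernel_ge (hK : IsCompact K) (hμ : BddDensity K μ)
    (h0 : ∀ᵐ x, 0 ≤ μ x) (hm : ∫ x, μ x = m) {a : E2}
    (hsupp : ∀ x, x ∉ ball a ε → μ x = 0) :
    m ^ 2 * Real.log (1 / (2 * ε)) ≤ mutualEnergy logKernel μ μ := by
  have hpot : ∀ x ∈ K, x ∈ ball a ε → m * Real.log (1 / (2 * ε)) ≤ pot logKernel μ x := by
    intro x hxK hx
    rw [← hm, mul_comm, ← integral_const_mul]
    refine integral_mono_ae ((hμ.integrable hK).const_mul _)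
      (integrable_kernel_mul hK.measurableSet (integrableKernel_logKernel hK) hμ hxK) ?_
    filter_upwards [h0, Measure.ae_ne volume x] with y hy hxy
    by_cases hya : y ∈ ball a ε
    · refine mul_le_mul_of_nonneg_right ?_ hy
      have hd : 0 < dist x y := dist_pos.2 hxy.symm
      have hd2 : dist x y ≤ 2 * ε := by
        have := dist_triangle_right x y a
        rw [mem_ball] at hx hya
        linarith
      exact Real.log_le_log (one_div_pos.2 (hd.trans_le hd2)) (one_div_le_one_div_of_le hd hd2)
    · simp [hsupp y hya]
  have h1 : ∫ x, μ x * (m * Real.log (1 / (2 * ε))) ≤ mutualEnergy logKernel μ μ := by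
    refine integral_mono_ae ((hμ.integrable hK).mul_const _)
      (integrable_mul_pot hK.measurableSet (integrableKernel_logKernel hK) hμ hμ) ?_
    filter_upwards [h0] with x hx
    by_cases hxa : x ∈ ball a ε
    · by_cases hxK : x ∈ K
      · exact mul_le_mul_of_nonneg_left (hpot x hxK hxa) hx
      · simp [hμ.2.1 x hxK]
    · simp [hsupp x hxa]
  rw [integral_mul_const, hm] at h1
  linarith

/-- A density of mass `m` bounded by `lam` whose logarithmic energy is nearly maximal has nearly
maximal potential on some disc of radius `2 * ε`. -/
theorem exists_ball_pot_logKernel_ge {a : E2} {δ C : ℝ} (hμ : BddDensity (closedBall a δ) μ)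
    (hsupp : ∀ x, x ∉ ball a δ → μ x = 0)
    (h0 : ∀ᵐ x, 0 ≤ μ x) (hle : ∀ᵐ x, μ x ≤ lam) (hm : ∫ x, μ x = m) (hm0 : 0 < m)
    (hε : 0 < ε) (hεδ : 2 * ε ≤ δ)
    (hen : m ^ 2 * Real.log (1 / ε) - C ≤ mutualEnergy logKernel μ μ) :
    ∃ x₂, ball x₂ (2 * ε) ⊆ ball a δ ∧ ∀ x ∈ ball x₂ (2 * ε),
      m * Real.log (1 / ε) - (C / m + 1 + m * Real.log 5 + lam * ε ^ 2 * ∫ z, logCore z) ≤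
        pot logKernel μ x := by
  have hK : IsCompact (closedBall a δ) := isCompact_closedBall a δ
  obtain ⟨x₁, hx₁, hpot⟩ : ∃ x₁ ∈ ball a δ,
      m * Real.log (1 / ε) - (C / m + 1) ≤ pot logKernel μ x₁ := by
    by_contra! hcon
    have h1 : mutualEnergy logKernel μ μ ≤
        ∫ x, μ x * (m * Real.log (1 / ε) - (C / m + 1)) := by
      refine integral_mono_ae
        (integrable_mul_pot hK.measurableSet (integrableKernel_logKernel hK) hμ hμ)
        ((hμ.integrable hK).mul_const _) ?_
      filter_upwards [h0] with x hx
      by_cases hxa : x ∈ ball a δ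
      · exact mul_le_mul_of_nonneg_left (hcon x hxa).le hx
      · simp [hsupp x hxa]
    rw [integral_mul_const, hm] at h1
    have h2 : m * (m * Real.log (1 / ε) - (C / m + 1)) = m ^ 2 * Real.log (1 / ε) - C - m := by
      field_simp
      ring
    linarith
  have hδ : 0 < δ := by linarith
  have hs : 2 * ε / δ ≤ 1 := (div_le_one hδ).2 hεδ
  have hs0 : 0 < 2 * ε / δ := by positivity
  have hn : ‖x₁ - a‖ < δ := by rwa [← dist_eq_norm]
  have hsδ : 2 * ε / δ * δ = 2 * ε := by field_simp
  have hda : dist (a + (1 - 2 * ε / δ) • (x₁ - a)) a ≤ δ - 2 * ε := by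
    rw [dist_eq_norm, add_sub_cancel_left, norm_smul, Real.norm_of_nonneg (by linarith)]
    nlinarith
  have hd₁ : dist (a + (1 - 2 * ε / δ) • (x₁ - a)) x₁ ≤ 2 * ε := by
    have : a + (1 - 2 * ε / δ) • (x₁ - a) - x₁ = (-(2 * ε / δ)) • (x₁ - a) := by module
    rw [dist_eq_norm, this, norm_smul, norm_neg, Real.norm_of_nonneg hs0.le]
    nlinarith
  have hsub : ball (a + (1 - 2 * ε / δ) • (x₁ - a)) (2 * ε) ⊆ ball a δ :=
    ball_subset_ball' (by linarith)
  refine ⟨_, hsub, fun x hx => ?_⟩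
  have hxx₁ : dist x x₁ ≤ 4 * ε := by
    have := dist_triangle x (a + (1 - 2 * ε / δ) • (x₁ - a)) x₁
    rw [mem_ball] at hx
    linarith
  have := pot_logKernel_nearby hK hμ h0 hle hm hε (ball_subset_closedBall (hsub hx))
    (ball_subset_closedBall hx₁) hxx₁
  linarith

end LogKernel

section Variation

theorem nonpos_of_forall_mul_add_sq_mul_nonpos {A B : ℝ}
    (h : ∀ t : ℝ, 0 < t → t ≤ 1 → t * A + t ^ 2 * B ≤ 0) : A ≤ 0 := by
  by_contra! hA
  have hB : 0 < A + |B| := by positivity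
  have ht : 0 < A / (2 * (A + |B|)) := by positivity
  have ht1 : A / (2 * (A + |B|)) ≤ 1 := by
    rw [div_le_one (by positivity)]
    linarith [abs_nonneg B]
  have h1 := h _ ht ht1
  have h2 : A / (2 * (A + |B|)) * |B| ≤ A / 2 := by
    rw [div_mul_eq_mul_div, div_le_div_iff₀ (by positivity) two_pos]
    nlinarith [abs_nonneg B]
  nlinarith [neg_abs_le B, mul_le_mul_of_nonneg_left (neg_abs_le B) ht.le]

/-- The bathtub principle: if a density with `0 ≤ μ ≤ lam` maximizes `∫ f η` among the densities
`η` in `B` with the same mass, and `f ≥ c` on a large subset of `B`, then `f ≥ c` almost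
everywhere on `{μ > 0}`. -/
theorem ae_le_of_first_variation {B Q : Set E2} {f μ : E2 → ℝ} {c lam m : ℝ}
    (hB : MeasurableSet B) (hBfin : volume B ≠ ⊤) (hμ : BddDensity B μ)
    (h0 : ∀ᵐ x, 0 ≤ μ x) (hle : ∀ᵐ x, μ x ≤ lam) (hm : ∫ x, μ x = m) (hm0 : 0 < m)
    (hf : IntegrableOn f B) (hQ : MeasurableSet Q) (hQB : Q ⊆ B) (hQf : ∀ x ∈ Q, c ≤ f x)
    (hQm : 2 * m ≤ lam * volume.real Q)
    (hvar : ∀ η : E2 → ℝ, Measurable η → (∀ x, x ∉ B → η x = 0) → ∫ x, η x = m →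
      (∀ᵐ x, 0 ≤ η x) → (∀ᵐ x, η x ≤ lam) → ∫ x, (η x - μ x) * f x ≤ 0) :
    ∀ᵐ x, x ∈ B → 0 < μ x → c ≤ f x := by
  obtain ⟨g, hgm, hfg⟩ := hf.aestronglyMeasurable
  have hμi : Integrable μ := by
    simpa using hμ.integrable_mul (g := fun _ => 1) hB (integrableOn_const hBfin)
  have hQfin : volume Q ≠ ⊤ := measure_ne_top_of_subset hQB hBfin
  set S : Set E2 := {x | g x < c} ∩ {x | 0 < μ x} ∩ (B \ Q) with hS
  have hSm : MeasurableSet S :=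
    ((measurableSet_lt hgm.measurable measurable_const).inter
      (measurableSet_lt measurable_const hμ.1)).inter (hB.diff hQ)
  have hSQ : ∀ x ∈ S, x ∉ Q := fun x hx => hx.2.2
  set mS : ℝ := ∫ x in S, μ x with hmS
  set M : ℝ := ∫ x in Q, (lam - μ x) with hM
  have hmS0 : 0 ≤ mS := integral_nonneg_of_ae (ae_restrict_of_ae h0)
  have hmSm : mS ≤ m := hm ▸ setIntegral_le_integral hμi h0
  have hMm : m ≤ M := by
    have h1 : ∫ x in Q, μ x ≤ m := hm ▸ setIntegral_le_integral hμi h0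
    have hci : Integrable (fun _ : E2 => lam) (volume.restrict Q) := integrableOn_const hQfin
    rw [hM, integral_sub hci hμi.integrableOn, setIntegral_const,
      smul_eq_mul]
    linarith
  have hM0 : 0 < M := hm0.trans_le hMm
  set ρ : ℝ := mS / M with hρ
  have hρ0 : 0 ≤ ρ := by positivity
  have hρ1 : ρ ≤ 1 := (div_le_one hM0).2 (hmSm.trans hMm)
  set θ : E2 → ℝ := fun x => ρ * Q.indicator (fun x => lam - μ x) x - S.indicator μ x with hθ
  have hθm : Measurable θ :=
    (((measurable_const.sub hμ.1).indicator hQ).const_mul ρ).sub (hμ.1.indicator hSm)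
  have hθS : ∀ x ∈ S, θ x = -μ x := fun x hx => by simp [hθ, hx, hSQ x hx]
  have hθQ : ∀ x ∈ Q, θ x = ρ * (lam - μ x) := fun x hx => by
    have : x ∉ S := fun h => hSQ x h hx
    simp [hθ, hx, this]
  have hθ0 : ∀ x, x ∉ S → x ∉ Q → θ x = 0 := fun x hx hx' => by simp [hθ, hx, hx']
  have hθB : ∀ x, x ∉ B → θ x = 0 := fun x hx =>
    hθ0 x (fun h => hx h.2.1) fun h => hx (hQB h)
  have hQi : IntegrableOn (fun x => lam - μ x) Q :=
    (integrableOn_const hQfin).sub hμi.integrableOn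
  have hθint : ∫ x, θ x = 0 := by
    rw [hθ, integral_sub (((integrable_indicator_iff hQ).2 hQi).const_mul ρ)
      (hμi.indicator hSm), integral_const_mul, integral_indicator hQ, integral_indicator hSm,
      ← hmS, ← hM, hρ]
    field_simp
    ring
  have hθbd : ∀ᵐ x, |θ x| ≤ lam := by
    filter_upwards [h0, hle] with x hx hx'
    by_cases hxS : x ∈ S
    · rw [hθS x hxS, abs_neg, abs_of_nonneg hx]; exact hx'
    by_cases hxQ : x ∈ Q
    · rw [hθQ x hxQ, abs_of_nonneg (mul_nonneg hρ0 (by linarith))]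
      nlinarith
    · rw [hθ0 x hxS hxQ, abs_zero]; linarith
  have hθB' : BddDensity B θ := ⟨hθm, hθB, lam, hθbd⟩
  have hθi : Integrable θ := by
    simpa using hθB'.integrable_mul (g := fun _ => 1) hB (integrableOn_const hBfin)
  have hθf : Integrable fun x => f x * θ x := hθB'.integrable_mul hB hf
  have h1 := hvar (μ + θ) (hμ.1.add hθm) (fun x hx => by simp [hμ.2.1 x hx, hθB x hx])
    (by
      have := integral_add hμi hθi
      simp only [Pi.add_apply]
      rw [this, hm, hθint, add_zero])
    (by
      filter_upwards [h0, hle] with x hx hx'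
      by_cases hxS : x ∈ S
      · simp [hθS x hxS]
      by_cases hxQ : x ∈ Q
      · simp only [Pi.add_apply, hθQ x hxQ]
        have := mul_nonneg hρ0 (sub_nonneg.2 hx')
        linarith
      · simpa [hθ0 x hxS hxQ] using hx)
    (by
      filter_upwards [h0, hle] with x hx hx'
      by_cases hxS : x ∈ S
      · simp only [Pi.add_apply, hθS x hxS]; linarith
      by_cases hxQ : x ∈ Q
      · simp only [Pi.add_apply, hθQ x hxQ]
        nlinarith [mul_nonneg (sub_nonneg.2 hρ1) (sub_nonneg.2 hx')]
      · simpa [hθ0 x hxS hxQ] using hx')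
  simp only [Pi.add_apply, add_sub_cancel_left] at h1
  have h2 : ∫ x, (f x * θ x - c * θ x) ≤ 0 := by
    rw [integral_sub hθf (hθi.const_mul c), integral_const_mul, hθint, mul_zero, sub_zero]
    simpa only [mul_comm] using h1
  rw [Filter.EventuallyEq, ae_restrict_iff' hB] at hfg
  have h3 : 0 ≤ᵐ[volume] fun x => f x * θ x - c * θ x := by
    filter_upwards [hfg, h0, hle] with x hfx hx hx'
    rw [Pi.zero_apply, ← sub_mul]
    by_cases hxS : x ∈ S
    · have hgx : g x < c := hxS.1.1
      rw [← hfx hxS.2.1] at hgx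
      rw [hθS x hxS]
      nlinarith
    by_cases hxQ : x ∈ Q
    · rw [hθQ x hxQ]
      exact mul_nonneg (sub_nonneg.2 (hQf x hxQ)) (mul_nonneg hρ0 (sub_nonneg.2 hx'))
    · simp [hθ0 x hxS hxQ]
  have h4 := (integral_eq_zero_iff_of_nonneg_ae h3 (hθf.sub (hθi.const_mul c))).1
    (le_antisymm h2 (integral_nonneg_of_ae h3))
  filter_upwards [hfg, h4] with x hfx hx hxB hxμ
  by_contra! hlt
  have hxQ : x ∉ Q := fun hxQ => (hQf x hxQ).not_gt hlt
  have hxS : x ∈ S := ⟨⟨by rwa [Set.mem_ofPred_eq, ← hfx hxB], hxμ⟩, hxB, hxQ⟩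
  rw [Pi.zero_apply, ← sub_mul, hθS x hxS] at hx
  nlinarith

variable {K : Set E2}

theorem abs_mutualEnergy_le {k : E2 → E2 → ℝ} {b : E2 → ℝ} {M : ℝ} (hK : IsCompact K)
    (hM : ∀ x ∈ K, ∀ y ∈ K, |k x y| ≤ M) (hb : BddDensity K b) :
    |mutualEnergy k b b| ≤ M * (∫ y, |b y|) ^ 2 := by
  have hi := hb.integrable hK
  have : M * (∫ y, |b y|) ^ 2 = ∫ x, |b x| * (M * ∫ y, |b y|) := by
    rw [integral_mul_const]; ring
  rw [this, ← Real.norm_eq_abs]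
  refine norm_integral_le_of_norm_le (hi.abs.mul_const _) (.of_forall fun x => ?_)
  by_cases hx : x ∈ K
  · rw [norm_mul]
    refine mul_le_mul_of_nonneg_left (abs_pot_le hi fun y hy => hM x hx y ?_) (norm_nonneg _)
    by_contra hyK
    exact hy (hb.2.1 y hyK)
  · simp [hb.2.1 x hx]

theorem pot_eq_sub {G k h : E2 → E2 → ℝ} {b : E2 → ℝ} {α : ℝ} (hK : MeasurableSet K)
    (hk : IntegrableKernel K k) (hh : IntegrableKernel K h)
    (hG : ∀ x y, G x y = α * k x y - h x y) (hb : BddDensity K b) {x : E2} (hx : x ∈ K) :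
    pot G b x = α * pot k b x - pot h b x := by
  rw [pot, pot, pot, ← integral_const_mul,
    ← integral_sub ((integrable_kernel_mul hK hk hb hx).const_mul α)
      (integrable_kernel_mul hK hh hb hx)]
  congr! 2 with y
  rw [hG]; ring

theorem mutualEnergy_eq_sub {G k h : E2 → E2 → ℝ} {a b : E2 → ℝ} {α : ℝ} (hK : MeasurableSet K)
    (hk : IntegrableKernel K k) (hh : IntegrableKernel K h)
    (hG : ∀ x y, G x y = α * k x y - h x y) (ha : BddDensity K a) (hb : BddDensity K b) :
    mutualEnergy G a b = α * mutualEnergy k a b - mutualEnergy h a b := by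
  rw [mutualEnergy, mutualEnergy, mutualEnergy, ← integral_const_mul,
    ← integral_sub ((integrable_mul_pot hK hk ha hb).const_mul α)
      (integrable_mul_pot hK hh ha hb)]
  refine integral_congr_ae (.of_forall fun x => ?_)
  by_cases hx : x ∈ K
  · simp only [pot_eq_sub hK hk hh hG hb hx]; ring
  · simp [ha.2.1 x hx]

end Variation

section Vortex

/-- The logarithmic energy defect of a maximizing vortex of mass `m`, when the regular part of the
kernel is bounded by `M` and the background field by `R`. -/
def energyDefect (m M R : ℝ) : ℝ :=
  m ^ 2 * Real.log 2 + 2 * (2 * π) * (2 * m * R + 2 * m ^ 2 * M)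

/-- A bound for the oscillation, on the support of a maximizing vortex, of its stream function. -/
def oscillationBound (m M R : ℝ) : ℝ :=
  1 / (2 * π) * (energyDefect m M R / m + 1 + m * Real.log 5 + 2 * (m / π * ∫ z, logCore z)) +
    2 * R

theorem volume_real_ball_E2 (a : E2) {r : ℝ} (hr : 0 ≤ r) : volume.real (ball a r) = π * r ^ 2 := by
  rw [measureReal_def, EuclideanSpace.volume_ball_fin_two, ENNReal.toReal_mul, ENNReal.toReal_pow,
    ENNReal.toReal_ofReal hr]
  simp [mul_comm, pi_nonneg]

/-- If a density `μ` of mass `m` with `0 ≤ μ ≤ lam` in a disc maximizes its energy in a bounded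
background field, then its stream function `f` stays within a fixed distance, independent of
`lam`, of a lower bound of `f` on `{μ > 0}`. -/
theorem exists_lower_bound_of_maximizer {a : E2} {δ m lam ε M R : ℝ}
    {G h : E2 → E2 → ℝ} {f μ : E2 → ℝ}
    (hG : ∀ x y, G x y = 1 / (2 * π) * logKernel x y - h x y)
    (hh : IntegrableKernel (closedBall a δ) h)
    (hM : ∀ x ∈ closedBall a δ, ∀ y ∈ closedBall a δ, |h x y| ≤ M)
    (hμm : Measurable μ) (hsupp : ∀ x, x ∉ ball a δ → μ x = 0)
    (h0 : ∀ᵐ x, 0 ≤ μ x) (hle : ∀ᵐ x, μ x ≤ lam) (hm : ∫ x, μ x = m) (hm0 : 0 < m)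
    (hε : 0 < ε) (hεδ : 2 * ε ≤ δ) (hlam : lam * (π * ε ^ 2) = m)
    (hf : IntegrableOn f (ball a δ))
    (hfR : ∀ x ∈ ball a δ, |f x - 1 / (2 * π) * pot logKernel μ x| ≤ R)
    (hvar : ∀ η : E2 → ℝ, Measurable η → (∀ x, x ∉ ball a δ → η x = 0) → ∫ x, η x = m →
      (∀ᵐ x, 0 ≤ η x) → (∀ᵐ x, η x ≤ lam) → ∀ t : ℝ, 0 < t → t ≤ 1 →
      t * (∫ x, (η x - μ x) * f x) + t ^ 2 * (mutualEnergy G (η - μ) (η - μ) / 2) ≤ 0) :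
    ∃ c, (∀ x ∈ ball a δ, f x ≤ c + oscillationBound m M R) ∧
      ∀ᵐ x, x ∈ ball a δ → 0 < μ x → c ≤ f x := by
  have hK : IsCompact (closedBall a δ) := isCompact_closedBall a δ
  have hKm := hK.measurableSet
  have hk := integrableKernel_logKernel hK
  have hα : 0 < 1 / (2 * π) := by positivity
  have hlam0 : 0 < lam := by
    by_contra! hneg
    nlinarith [mul_nonneg (neg_nonneg.2 hneg) (by positivity : 0 ≤ π * ε ^ 2)]
  have hlamε : lam * ε ^ 2 = m / π := by
    rw [eq_div_iff pi_ne_zero, ← hlam]; ring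
  have hbdd : ∀ η : E2 → ℝ, Measurable η → (∀ x, x ∉ ball a δ → η x = 0) →
      (∀ᵐ x, 0 ≤ η x) → (∀ᵐ x, η x ≤ lam) → BddDensity (ball a δ) η := by
    intro η h1 h2 h3 h4
    refine ⟨h1, h2, lam, ?_⟩
    filter_upwards [h3, h4] with x hx hx'
    rwa [abs_of_nonneg hx]
  have hμb := hbdd μ hμm hsupp h0 hle
  have hμ : BddDensity (closedBall a δ) μ := hμb.mono ball_subset_closedBall
  have hεδ' : ball a ε ⊆ ball a δ := ball_subset_ball (by linarith)
  set η : E2 → ℝ := (ball a ε).indicator fun _ => lam with hη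
  have hηm : Measurable η := measurable_const.indicator measurableSet_ball
  have hηε : ∀ x, x ∉ ball a ε → η x = 0 := fun x hx => by simp only [hη, Set.indicator_of_notMem hx]
  have hηsupp : ∀ x, x ∉ ball a δ → η x = 0 := fun x hx => hηε x fun h => hx (hεδ' h)
  have hη0 : ∀ x, 0 ≤ η x := fun x => Set.indicator_nonneg (fun _ _ => hlam0.le) x
  have hηle : ∀ x, η x ≤ lam := fun x => Set.indicator_le_self' (fun _ _ => hlam0.le) x
  have hηint : ∫ x, η x = m := by
    rw [hη, integral_indicator measurableSet_ball, setIntegral_const, volume_real_ball_E2 _ hε.le,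
      smul_eq_mul, ← hlam, mul_comm]
  have hηb := (hbdd η hηm hηsupp (.of_forall hη0) (.of_forall hηle))
  have hη' : BddDensity (closedBall a δ) η := hηb.mono ball_subset_closedBall
  have hθb : BddDensity (ball a δ) (η - μ) := by
    have := hηb.add (hμb.smul (-1))
    rwa [neg_one_smul, ← sub_eq_add_neg] at this
  have hθ : BddDensity (closedBall a δ) (η - μ) := hθb.mono ball_subset_closedBall
  have hμi := hμ.integrable hK
  have hηi := hη'.integrable hK
  have hθi := hθ.integrable hK
  have hθabs : ∫ x, |(η - μ) x| ≤ 2 * m := by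
    have : ∫ x, |(η - μ) x| ≤ ∫ x, (η x + μ x) := by
      refine integral_mono_ae hθi.abs (hηi.add hμi) ?_
      filter_upwards [h0] with x hx
      simp only [Pi.sub_apply]
      rw [abs_le]
      constructor <;> linarith [hη0 x]
    rw [integral_add hηi hμi, hηint, hm] at this
    linarith
  have hθabs0 : 0 ≤ ∫ x, |(η - μ) x| := integral_nonneg fun _ => abs_nonneg _
  have ha : a ∈ ball a δ := mem_ball_self (by linarith)
  have hM0 : 0 ≤ M := (abs_nonneg _).trans
    (hM a (ball_subset_closedBall ha) a (ball_subset_closedBall ha))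
  have hR0 : 0 ≤ R := (abs_nonneg _).trans (hfR a ha)
  have hfi : Integrable fun x => (η - μ) x * f x := by
    simpa only [mul_comm] using hθb.integrable_mul measurableSet_ball hf
  have hpi := (integrable_mul_pot hKm hk hθ hμ).const_mul (1 / (2 * π))
  have hlin : 1 / (2 * π) * mutualEnergy logKernel (η - μ) μ - R * (2 * m) ≤
      ∫ x, (η x - μ x) * f x := by
    have h1 : |(∫ x, (η - μ) x * f x) - 1 / (2 * π) * mutualEnergy logKernel (η - μ) μ| ≤
        R * ∫ x, |(η - μ) x| := by
      rw [mutualEnergy, ← integral_const_mul, ← integral_sub hfi hpi, ← integral_const_mul,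
        ← Real.norm_eq_abs]
      refine norm_integral_le_of_norm_le (hθi.abs.const_mul R) (.of_forall fun x => ?_)
      by_cases hx : x ∈ ball a δ
      · have : (η - μ) x * f x - 1 / (2 * π) * ((η - μ) x * pot logKernel μ x) =
            (f x - 1 / (2 * π) * pot logKernel μ x) * (η - μ) x := by ring
        rw [this, norm_mul]
        exact mul_le_mul_of_nonneg_right (hfR x hx) (norm_nonneg _)
      · simp [hθb.2.1 x hx]
    have h2 := (abs_le.1 h1).1
    have h3 := mul_le_mul_of_nonneg_left hθabs hR0
    simp only [Pi.sub_apply] at h2 h3 ⊢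
    linarith
  have hquad : 1 / (2 * π) * mutualEnergy logKernel (η - μ) (η - μ) - M * (2 * m) ^ 2 ≤
      mutualEnergy G (η - μ) (η - μ) := by
    rw [mutualEnergy_eq_sub hKm hk hh hG hθ hθ]
    have h1 := (abs_le.1 (abs_mutualEnergy_le hK hM hθ)).2
    have h2 : M * (∫ x, |(η - μ) x|) ^ 2 ≤ M * (2 * m) ^ 2 := by gcongr
    linarith
  have hexp : mutualEnergy logKernel η η = mutualEnergy logKernel μ μ +
      2 * mutualEnergy logKernel (η - μ) μ + mutualEnergy logKernel (η - μ) (η - μ) := by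
    have := mutualEnergy_add_smul hKm hk (fun x _ y _ => logKernel_comm x y) hμ hθ 1
    rw [one_smul, add_sub_cancel] at this
    linarith
  have hηen := mutualEnergy_logKernel_ge hK hη' (.of_forall hη0) hηint hηε
  have hlog : Real.log (1 / (2 * ε)) = Real.log (1 / ε) - Real.log 2 := by
    rw [one_div, one_div, Real.log_inv, Real.log_inv, Real.log_mul two_ne_zero hε.ne']
    ring
  have hen : m ^ 2 * Real.log (1 / ε) - energyDefect m M R ≤ mutualEnergy logKernel μ μ := by
    have h1 := hvar η hηm hηsupp hηint (.of_forall hη0) (.of_forall hηle) 1 one_pos le_rfl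
    have h2 : 1 / (2 * π) * (mutualEnergy logKernel η η - mutualEnergy logKernel μ μ) ≤
        2 * (2 * m * R + 2 * m ^ 2 * M) := by
      rw [hexp]
      linarith
    rw [one_div, inv_mul_le_iff₀ (by positivity)] at h2
    rw [hlog] at hηen
    rw [energyDefect]
    linarith
  obtain ⟨x₂, hsub, hx₂⟩ := exists_ball_pot_logKernel_ge hμ hsupp h0 hle hm hm0 hε hεδ hen
  rw [hlamε] at hx₂
  have hball : volume (ball a δ) ≠ ⊤ := measure_ball_lt_top.ne
  refine ⟨1 / (2 * π) * (m * Real.log (1 / ε) - (energyDefect m M R / m + 1 + m * Real.log 5 +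
    m / π * ∫ z, logCore z)) - R, fun x hx => ?_, ?_⟩
  · have h1 := pot_logKernel_le hK hμ h0 hle hm hε (ball_subset_closedBall hx)
    rw [hlamε] at h1
    have h2 := mul_le_mul_of_nonneg_left h1 hα.le
    have h3 := (abs_le.1 (hfR x hx)).2
    rw [oscillationBound]
    linarith
  · refine ae_le_of_first_variation measurableSet_ball hball hμb h0 hle hm hm0 hf
      measurableSet_ball hsub (fun x hx => ?_) ?_ fun ζ h1 h2 h3 h4 h5 =>
        nonpos_of_forall_mul_add_sq_mul_nonpos (hvar ζ h1 h2 h3 h4 h5)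
    · have h2 := mul_le_mul_of_nonneg_left (hx₂ x hx) hα.le
      have h3 := (abs_le.1 (hfR x (hsub hx))).1
      linarith
    · rw [volume_real_ball_E2 _ (by positivity)]
      linarith

end Vortex

section Configuration

variable {K : Set E2} {k : E2 → E2 → ℝ} {a b : E2 → ℝ}

theorem integrableKernel_of_continuousOn (hK : IsCompact K)
    (hk : ContinuousOn (fun q : E2 × E2 => k q.1 q.2) (K ×ˢ K)) : IntegrableKernel K k := by
  refine ⟨hk.integrableOn_compact (hK.prod hK), fun x hx => ?_⟩
  refine ContinuousOn.integrableOn_compact hK ?_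
  exact hk.comp (f := fun y => (x, y)) (by fun_prop) fun y hy => ⟨hx, hy⟩

theorem IntegrableKernel.sub_const_mul {G h : E2 → E2 → ℝ} {α : ℝ} (hk : IntegrableKernel K k)
    (hh : IntegrableKernel K h) (hG : ∀ x y, G x y = α * k x y - h x y) :
    IntegrableKernel K G := by
  constructor
  · simp only [hG]
    exact (hk.1.const_mul α).sub hh.1
  · intro x hx
    have : G x = fun y => α * k x y - h x y := funext (hG x)
    rw [this]
    exact ((hk.2 x hx).const_mul α).sub (hh.2 x hx)

theorem mutualEnergy_smul_left (t : ℝ) : mutualEnergy k (t • a) b = t * mutualEnergy k a b := by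
  simp only [mutualEnergy, ← integral_const_mul, Pi.smul_apply, smul_eq_mul, mul_assoc]

theorem integral_mul_pot_add_sum {ι : Type*} (s : Finset ι) (hK : MeasurableSet K)
    (hk : IntegrableKernel K k) (ha : BddDensity K a) (hb : BddDensity K b)
    {w : ι → ℝ} {z : ι → E2} (hz : ∀ j ∈ s, z j ∈ K) :
    ∫ x, a x * (pot k b x + ∑ j ∈ s, w j * k (z j) x) =
      mutualEnergy k a b + ∑ j ∈ s, w j * pot k a (z j) := by
  have hi : ∀ j ∈ s, Integrable fun x => w j * (k (z j) x * a x) := fun j hj =>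
    (integrable_kernel_mul hK hk ha (hz j hj)).const_mul _
  have h : ∀ x, a x * (pot k b x + ∑ j ∈ s, w j * k (z j) x) =
      a x * pot k b x + ∑ j ∈ s, w j * (k (z j) x * a x) := fun x => by
    rw [mul_add, Finset.mul_sum]
    congr 1
    exact Finset.sum_congr rfl fun j _ => by ring
  simp only [h]
  rw [integral_add (integrable_mul_pot hK hk ha hb) (integrable_finsetSum _ hi),
    integral_finsetSum _ hi, mutualEnergy]
  simp only [integral_const_mul, pot]

theorem exists_bound_kernels {h G : E2 → E2 → ℝ} {d : ℝ} (hK : IsCompact K) (hd : 0 < d)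
    (hcont : ContinuousOn (fun q : E2 × E2 => h q.1 q.2) (K ×ˢ K))
    (hG : ∀ x y, G x y = 1 / (2 * π) * logKernel x y - h x y) :
    ∃ M, 0 ≤ M ∧ (∀ x ∈ K, ∀ y ∈ K, |h x y| ≤ M) ∧
      ∀ x ∈ K, ∀ y ∈ K, d ≤ dist x y → |G x y| ≤ M := by
  obtain ⟨M₁, hM₁⟩ := (hK.prod hK).exists_bound_of_continuousOn hcont
  have hN : IsCompact ((K ×ˢ K) ∩ {q : E2 × E2 | d ≤ dist q.1 q.2}) :=
    (hK.prod hK).inter_right (isClosed_le continuous_const continuous_dist)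
  have hGc : ContinuousOn (fun q : E2 × E2 => G q.1 q.2)
      ((K ×ˢ K) ∩ {q : E2 × E2 | d ≤ dist q.1 q.2}) := by
    simp only [hG, logKernel]
    have hne : ∀ q ∈ (K ×ˢ K) ∩ {q : E2 × E2 | d ≤ dist q.1 q.2}, dist q.1 q.2 ≠ 0 :=
      fun q hq => (hd.trans_le hq.2).ne'
    refine ContinuousOn.sub (continuousOn_const.mul (ContinuousOn.log ?_ ?_))
      (hcont.mono Set.inter_subset_left)
    · exact ContinuousOn.div continuousOn_const continuous_dist.continuousOn hne
    · exact fun q hq => one_div_ne_zero (hne q hq)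
  obtain ⟨M₂, hM₂⟩ := hN.exists_bound_of_continuousOn hGc
  refine ⟨max 0 (max M₁ M₂), le_max_left _ _, fun x hx y hy => ?_, fun x hx y hy hxy => ?_⟩
  · exact (hM₁ (x, y) ⟨hx, hy⟩).trans ((le_max_left _ _).trans (le_max_right _ _))
  · exact (hM₂ (x, y) ⟨⟨hx, hy⟩, hxy⟩).trans ((le_max_right _ _).trans (le_max_right _ _))

theorem exists_disc_radius {m lam δ : ℝ} (hm : 0 < m) (hδ : 0 < δ)
    (hlam : 4 * m / (π * δ ^ 2) ≤ lam) :
    ∃ ε, 0 < ε ∧ 2 * ε ≤ δ ∧ lam * (π * ε ^ 2) = m := by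
  have hlam0 : 0 < lam := lt_of_lt_of_le (by positivity) hlam
  refine ⟨√(m / (π * lam)), by positivity, ?_, ?_⟩
  · refine abs_le_of_sq_le_sq' ?_ hδ.le |>.2
    rw [mul_pow, Real.sq_sqrt (by positivity)]
    rw [div_le_iff₀ (by positivity)] at hlam
    rw [← mul_div_assoc, div_le_iff₀ (by positivity)]
    linarith
  · rw [Real.sq_sqrt (by positivity)]
    field_simp

theorem sign_eq_one_or_neg_one {r : ℝ} (hr : r ≠ 0) : Real.sign r = 1 ∨ Real.sign r = -1 := by
  rcases Real.sign_apply_eq_of_ne_zero r hr with h | h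
  · exact .inr h
  · exact .inl h

theorem sign_mul_self_eq_abs (r : ℝ) : Real.sign r * r = |r| := by
  rcases lt_trichotomy r 0 with h | h | h
  · rw [Real.sign_of_neg h, abs_of_neg h]; ring
  · simp [h]
  · rw [Real.sign_of_pos h, abs_of_pos h, one_mul]

theorem le_essInf_of_ae_le_of_bounded {A : Set E2} {f : E2 → ℝ} {c U : ℝ} (hA : MeasurableSet A)
    (hA0 : volume A ≠ 0) (hU : ∀ x ∈ A, f x ≤ U) (hc : ∀ᵐ x, x ∈ A → c ≤ f x) :
    c ≤ essInf f (volume.restrict A) := by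
  have : (ae (volume.restrict A)).NeBot := by
    rw [ae_neBot]
    simpa using hA0
  have hle : ∀ᵐ x ∂volume.restrict A, f x ≤ U := (ae_restrict_iff' hA).2 (.of_forall hU)
  exact le_liminf_of_le (Filter.IsCoboundedUnder.of_frequently_le hle.frequently)
    ((ae_restrict_iff' hA).2 hc)

/-- Bound for the integral of `f - essInf f` against a density `μ`, the essential infimum being
taken over `{μ > 0}`. -/
theorem integral_mul_sub_essInf_le {B : Set E2} {f μ : E2 → ℝ} {c m Δ : ℝ} (hB : MeasurableSet B)
    (hμm : Measurable μ) (hμi : Integrable μ) (hsupp : ∀ x, x ∉ B → μ x = 0)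
    (h0 : ∀ᵐ x, 0 ≤ μ x) (hm : ∫ x, μ x = m) (hm0 : 0 < m) (hΔ : 0 ≤ Δ)
    (hf : ∀ x ∈ B, f x ≤ c + Δ) (hc : ∀ᵐ x, x ∈ B → 0 < μ x → c ≤ f x) :
    ∫ x, μ x * (f x - essInf f (volume.restrict {x ∈ B | 0 < μ x})) ≤ m * Δ := by
  have hA : MeasurableSet {x ∈ B | 0 < μ x} := hB.inter (measurableSet_lt measurable_const hμm)
  have hA0 : volume {x ∈ B | 0 < μ x} ≠ 0 := by
    intro hzero
    have h1 : ∀ᵐ x, x ∉ {x ∈ B | 0 < μ x} := measure_eq_zero_iff_ae_notMem.1 hzero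
    have h2 : μ =ᵐ[volume] 0 := by
      filter_upwards [h0, h1] with x hx hx'
      by_contra hne
      exact hx' ⟨by_contra fun hxB => hne (hsupp x hxB), hx.lt_of_ne' hne⟩
    rw [integral_congr_ae h2] at hm
    simp only [Pi.zero_apply, integral_zero] at hm
    exact hm0.ne hm
  have hess : c ≤ essInf f (volume.restrict {x ∈ B | 0 < μ x}) :=
    le_essInf_of_ae_le_of_bounded hA hA0 (fun x hx => hf x hx.1) (by
      filter_upwards [hc] with x hx hxA
      exact hx hxA.1 hxA.2)
  by_cases hi : Integrable fun x => μ x * (f x - essInf f (volume.restrict {x ∈ B | 0 < μ x}))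
  · rw [← hm, ← integral_mul_const]
    refine integral_mono_ae hi (hμi.mul_const _) ?_
    filter_upwards [h0] with x hx
    by_cases hxB : x ∈ B
    · exact mul_le_mul_of_nonneg_left (by linarith [hf x hxB]) hx
    · simp [hsupp x hxB]
  · rw [integral_undef hi]
    positivity

end Configuration

theorem kinetic_energy_bound
    (p l : ℕ) (hp : 0 < p) (hl : 0 < l)
    (D : Set E2) (hDopen : IsOpen D) (hDbdd : Bornology.IsBounded D)
    (hDsc : SimplyConnectedSpace D)
    (h : E2 → E2 → ℝ)
    (hcont : ContinuousOn (fun q : E2 × E2 => h q.1 q.2) (D ×ˢ D))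
    (hsymm : ∀ x ∈ D, ∀ y ∈ D, h x y = h y x)
    (hharm : ∀ y ∈ D, ContDiffOn ℝ 2 (fun x => h x y) D ∧
      ∀ x ∈ D, ∑ i : Fin 2,
        iteratedFDerivWithin ℝ 2 (fun x' => h x' y) D x
          ![EuclideanSpace.single i 1, EuclideanSpace.single i 1] = 0)
    (G : E2 → E2 → ℝ)
    (hG : ∀ x y, G x y = (1 / (2 * π)) * Real.log (1 / dist x y) - h x y)
    (hGbdry : ∀ y ∈ D, ∀ z ∈ frontier D,
      Tendsto (fun x => G x y) (𝓝[D] z) (𝓝 0))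
    (κ : Fin (p + l) → ℝ) (hκ : ∀ i, κ i ≠ 0)
    (xb : Fin (p + l) → E2) (hxbD : ∀ i, xb i ∈ D) (hxbinj : Function.Injective xb)
    (δ0 : ℝ) (hδ0 : 0 < δ0)
    (hball : ∀ i, closedBall (xb i) δ0 ⊆ D)
    (hdisj : ∀ i j, i ≠ j → Disjoint (closedBall (xb i) δ0) (closedBall (xb j) δ0))
    (KR : (Fin (p + l) → E2) → ℝ)
    (hKR : ∀ y, KR y =
      -(∑ i, ∑ j ∈ Finset.univ.filter (fun j => j ≠ i), κ i * κ j * G (y i) (y j))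
      + ∑ i, (κ i) ^ 2 * h (y i) (y i))
    (hmin : ∀ y : Fin (p + l) → E2, (∀ i, y i ∈ closedBall (xb i) δ0) →
      Function.Injective y → y ≠ xb → KR xb < KR y)
    (ψ : (E2 → ℝ) → E2 → ℝ)
    (hψ : ∀ ω x, ψ ω x = ∫ y in D, G x y * ω y)
    (En : (E2 → ℝ) → ℝ)
    (hEn : ∀ ω, En ω = (1 / 2) * ∫ x in D, ∫ y in D, G x y * ω x * ω y)
    (EE : (E2 → ℝ) → (Fin l → E2) → ℝ)
    (hEE : ∀ ω z, EE ω z = En ω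
      + ∑ j, κ (Fin.natAdd p j) * ψ ω (z j)
      + (1 / 2) * ∑ i, ∑ j ∈ Finset.univ.filter (fun j => j ≠ i),
          κ (Fin.natAdd p i) * κ (Fin.natAdd p j) * G (z i) (z j)
      - ∑ j, (κ (Fin.natAdd p j)) ^ 2 * ((1 / 2) * h (z j) (z j)))
    (Adm : ℝ → ℝ → (Fin p → E2 → ℝ) → Prop)
    (hAdm : ∀ δ lam ωs, Adm δ lam ωs ↔ ∀ i : Fin p,
      Measurable (ωs i)
      ∧ (∀ x, x ∉ ball (xb (Fin.castAdd l i)) δ → ωs i x = 0)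
      ∧ (∫ x in D, ωs i x) = κ (Fin.castAdd l i)
      ∧ (∀ᵐ x : E2 ∂volume, 0 ≤ Real.sign (κ (Fin.castAdd l i)) * ωs i x
          ∧ Real.sign (κ (Fin.castAdd l i)) * ωs i x ≤ lam))
    (δ : ℝ) (hδ : 0 < δ) (hδ2 : δ < δ0 / 2)
    (hbdry : ∀ lam, 0 < lam → ∀ (ωs : Fin p → E2 → ℝ) (z : Fin l → E2),
      Adm δ lam ωs ∧ (∀ j, z j ∈ closedBall (xb (Fin.natAdd p j)) δ) ∧
      (∀ (ωs' : Fin p → E2 → ℝ) (z' : Fin l → E2), Adm δ lam ωs' →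
        (∀ j, z' j ∈ closedBall (xb (Fin.natAdd p j)) δ) →
        EE (∑ i, ωs' i) z' ≤ EE (∑ i, ωs i) z) →
      ∀ i : Fin p, ∀ x ∈ sphere (xb (Fin.castAdd l i)) δ0,
        Real.sign (κ (Fin.castAdd l i)) * (ψ (∑ i', ωs i') x + ∑ j, κ (Fin.natAdd p j) * G (z j) x) ≤
        essInf (fun x => Real.sign (κ (Fin.castAdd l i)) * (ψ (∑ i', ωs i') x + ∑ j, κ (Fin.natAdd p j) * G (z j) x))
        (volume.restrict {x ∈ ball (xb (Fin.castAdd l i)) δ | 0 < Real.sign (κ (Fin.castAdd l i)) * ωs i x}))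
    :
    ∃ C > 0, ∃ lam1 > 0, ∀ lam, lam1 ≤ lam →
      ∀ (ωs : Fin p → E2 → ℝ) (z : Fin l → E2),
      (Adm δ lam ωs ∧ (∀ j, z j ∈ closedBall (xb (Fin.natAdd p j)) δ) ∧
      (∀ (ωs' : Fin p → E2 → ℝ) (z' : Fin l → E2), Adm δ lam ωs' →
        (∀ j, z' j ∈ closedBall (xb (Fin.natAdd p j)) δ) →
        EE (∑ i, ωs' i) z' ≤ EE (∑ i, ωs i) z)) →
      ∑ i : Fin p, (Real.sign (κ (Fin.castAdd l i)) / 2) *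
        ∫ x in D, ωs i x *
          (Real.sign (κ (Fin.castAdd l i)) * (ψ (∑ i', ωs i') x + ∑ j, κ (Fin.natAdd p j) * G (z j) x) -
            (essInf (fun x => Real.sign (κ (Fin.castAdd l i)) * (ψ (∑ i', ωs i') x + ∑ j, κ (Fin.natAdd p j) * G (z j) x))
        (volume.restrict {x ∈ ball (xb (Fin.castAdd l i)) δ | 0 < Real.sign (κ (Fin.castAdd l i)) * ωs i x}))) ≤ C := by
  set K : Set E2 := ⋃ i, closedBall (xb i) δ with hKdef
  have hK : IsCompact K := isCompact_iUnion fun i => isCompact_closedBall _ _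
  have hKm : MeasurableSet K := hK.measurableSet
  have hδδ0 : δ ≤ δ0 := by linarith
  have hbK : ∀ i, closedBall (xb i) δ ⊆ K := fun i => Set.subset_iUnion_of_subset i subset_rfl
  have hKD : K ⊆ D := Set.iUnion_subset fun i => (closedBall_subset_closedBall hδδ0).trans (hball i)
  have hcontK := hcont.mono (Set.prod_mono hKD hKD)
  have hhK : IntegrableKernel K h := integrableKernel_of_continuousOn hK hcontK
  have hGK : IntegrableKernel K G := (integrableKernel_logKernel hK).sub_const_mul hhK hG
  have hGsymm : ∀ x ∈ K, ∀ y ∈ K, G x y = G y x := fun x hx y hy => by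
    rw [hG, hG, dist_comm, hsymm x (hKD hx) y (hKD hy)]
  have hfar : ∀ i j, i ≠ j → ∀ x ∈ closedBall (xb i) δ, ∀ y ∈ closedBall (xb j) δ,
      δ0 / 2 ≤ dist x y := by
    intro i j hij x hx y hy
    have hy' : y ∉ closedBall (xb i) δ0 := fun h' => Set.disjoint_left.1 (hdisj i j hij) h'
      (closedBall_subset_closedBall hδδ0 hy)
    rw [mem_closedBall, not_le] at hy'
    rw [mem_closedBall] at hx
    have := dist_triangle_left y (xb i) x
    linarith
  obtain ⟨M, hM0, hMh, hMG⟩ := exists_bound_kernels hK (half_pos hδ0) hcontK hG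
  set R : ℝ := M * ∑ n, |κ n| with hRdef
  have hR0 : 0 ≤ R := mul_nonneg hM0 (Finset.sum_nonneg fun n _ => abs_nonneg _)
  set Δ : Fin p → ℝ := fun i => max 0 (oscillationBound |κ (Fin.castAdd l i)| M R) with hΔ
  have hΔ0 : ∀ i, 0 ≤ Δ i := fun i => le_max_left _ _
  refine ⟨1 + ∑ i, 1 / 2 * (|κ (Fin.castAdd l i)| * Δ i), ?_,
    1 + ∑ n, 4 * |κ n| / (π * δ ^ 2), ?_, ?_⟩
  · exact add_pos_of_pos_of_nonneg one_pos (Finset.sum_nonneg fun i _ =>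
      mul_nonneg (by norm_num) (mul_nonneg (abs_nonneg _) (hΔ0 i)))
  · exact add_pos_of_pos_of_nonneg one_pos (Finset.sum_nonneg fun i _ => by positivity)
  rintro lam hlam ωs z ⟨hadm, hz, hmax⟩
  have hadm' := (hAdm δ lam ωs).1 hadm
  have hzK : ∀ j ∈ (Finset.univ : Finset (Fin l)), z j ∈ K := fun j _ => hbK _ (hz j)
  have hint : ∀ (n : Fin (p + l)) (f : E2 → ℝ), (∀ x, x ∉ ball (xb n) δ → f x = 0) →
      ∫ x in D, f x = ∫ x, f x := fun n f hf =>
    setIntegral_eq_integral_of_forall_compl_eq_zero fun x hx =>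
      hf x fun hxb => hx (hKD (hbK n (ball_subset_closedBall hxb)))
  have hbdd : ∀ i, BddDensity (closedBall (xb (Fin.castAdd l i)) δ) (ωs i) := by
    intro i
    obtain ⟨h1, h2, h3, h4⟩ := hadm' i
    refine ⟨h1, fun x hx => h2 x fun h' => hx (ball_subset_closedBall h'), lam, ?_⟩
    filter_upwards [h4] with x hx
    rcases sign_eq_one_or_neg_one (hκ (Fin.castAdd l i)) with hs | hs <;> rw [hs] at hx <;>
      rw [abs_le] <;> constructor <;> linarith [hx.1, hx.2]
  have hbddK : ∀ i, BddDensity K (ωs i) := fun i => (hbdd i).mono (hbK _)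
  have hmass : ∀ i, ∫ x, |ωs i x| = |κ (Fin.castAdd l i)| := by
    intro i
    obtain ⟨h1, h2, h3, h4⟩ := hadm' i
    rw [hint _ _ h2] at h3
    rw [← sign_mul_self_eq_abs, ← h3, ← integral_const_mul]
    refine integral_congr_ae ?_
    filter_upwards [h4] with x hx
    rcases sign_eq_one_or_neg_one (hκ (Fin.castAdd l i)) with hs | hs <;> rw [h3, hs] <;>
      rw [hs] at hx
    · rw [abs_of_nonneg (by linarith [hx.1]), one_mul]
    · rw [abs_of_nonpos (by linarith [hx.1])]; ring
  set ω : E2 → ℝ := ∑ i, ωs i with hω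
  have hωK : BddDensity K ω := BddDensity.sum _ fun i _ => hbddK i
  have hψpot : ∀ {b : E2 → ℝ}, BddDensity K b → ∀ x, ψ b x = pot G b x := by
    intro b hb x
    rw [hψ, pot]
    exact setIntegral_eq_integral_of_forall_compl_eq_zero fun y hy => by
      rw [hb.2.1 y fun hyK => hy (hKD hyK), mul_zero]
  have hEnE : ∀ {b : E2 → ℝ}, BddDensity K b → En b = 1 / 2 * mutualEnergy G b b := by
    intro b hb
    have hb0 : ∀ x, x ∉ D → b x = 0 := fun x hx => hb.2.1 x fun hxK => hx (hKD hxK)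
    rw [hEn, mutualEnergy_eq_integral_integral,
      setIntegral_eq_integral_of_forall_compl_eq_zero fun x hx => by simp [hb0 x hx]]
    congr! 3
    exact setIntegral_eq_integral_of_forall_compl_eq_zero fun y hy => by simp [hb0 y hy]
  set F : E2 → ℝ := fun x => pot G ω x + ∑ j, κ (Fin.natAdd p j) * G (z j) x with hF
  have hexpand : ∀ θ, BddDensity K θ → ∀ t : ℝ,
      EE (ω + t • θ) z = EE ω z + (t * (∫ x, θ x * F x) + t ^ 2 * (mutualEnergy G θ θ / 2)) := by
    intro θ hθ t
    have hωθ := hωK.add (hθ.smul t)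
    have hpots : ∑ j, κ (Fin.natAdd p j) * pot G (ω + t • θ) (z j) =
        ∑ j, κ (Fin.natAdd p j) * pot G ω (z j) +
          t * ∑ j, κ (Fin.natAdd p j) * pot G θ (z j) := by
      rw [Finset.mul_sum, ← Finset.sum_add_distrib]
      refine Finset.sum_congr rfl fun j hj => ?_
      rw [pot_add hKm hGK hωK (hθ.smul t) (hzK j hj), pot_smul]
      ring
    rw [hF, integral_mul_pot_add_sum _ hKm hGK hθ hωK hzK, hEE, hEE, hEnE hωK, hEnE hωθ,
      mutualEnergy_add_smul hKm hGK hGsymm hωK hθ]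
    simp only [hψpot hωK, hψpot hωθ, hpots]
    ring
  have hFint : IntegrableOn F K := by
    refine (integrableOn_pot hK hGK hωK).add (integrable_finsetSum _ fun j hj => ?_)
    exact (hGK.2 _ (hzK j hj)).const_mul _
  have hmain : ∀ i, Real.sign (κ (Fin.castAdd l i)) / 2 *
      (∫ x in D, ωs i x * (Real.sign (κ (Fin.castAdd l i)) * F x -
        essInf (fun x => Real.sign (κ (Fin.castAdd l i)) * F x)
          (volume.restrict {x ∈ ball (xb (Fin.castAdd l i)) δ |
            0 < Real.sign (κ (Fin.castAdd l i)) * ωs i x}))) ≤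
      1 / 2 * (|κ (Fin.castAdd l i)| * Δ i) := by
    intro i
    obtain ⟨h1, h2, h3, h4⟩ := hadm' i
    rw [hint _ _ h2] at h3
    have hm0 : 0 < |κ (Fin.castAdd l i)| := abs_pos.2 (hκ _)
    have hs2 : Real.sign (κ (Fin.castAdd l i)) * Real.sign (κ (Fin.castAdd l i)) = 1 := by
      rcases sign_eq_one_or_neg_one (hκ (Fin.castAdd l i)) with hs | hs <;> rw [hs] <;> norm_num
    have hsκ := sign_mul_self_eq_abs (κ (Fin.castAdd l i))
    set s : ℝ := Real.sign (κ (Fin.castAdd l i)) with hs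
    set m : ℝ := |κ (Fin.castAdd l i)| with hm
    set a : E2 := xb (Fin.castAdd l i) with ha
    set μ : E2 → ℝ := s • ωs i with hμ
    have hμω : ωs i = s • μ := by rw [hμ, smul_smul, hs2, one_smul]
    have hμK : BddDensity K μ := (hbddK i).smul s
    have hsupp : ∀ x, x ∉ ball a δ → μ x = 0 := fun x hx => by simp [hμ, h2 x hx]
    have h0 : ∀ᵐ x, 0 ≤ μ x := h4.mono fun x hx => hx.1
    have hle : ∀ᵐ x, μ x ≤ lam := h4.mono fun x hx => hx.2
    have hmμ : ∫ x, μ x = m := by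
      rw [← hsκ, ← h3, ← integral_const_mul]
      rfl
    have habsμ : ∫ x, |μ x| = m := by
      rw [← hmμ]
      exact integral_congr_ae (h0.mono fun x hx => abs_of_nonneg hx)
    obtain ⟨ε, hε, hεδ, hlamε⟩ : ∃ ε, 0 < ε ∧ 2 * ε ≤ δ ∧ lam * (π * ε ^ 2) = m := by
      refine exists_disc_radius hm0 hδ (le_trans ?_ hlam)
      have := Finset.single_le_sum (f := fun n => 4 * |κ n| / (π * δ ^ 2))
        (fun n _ => by positivity) (Finset.mem_univ (Fin.castAdd l i))
      linarith
    have hfield : ∀ x ∈ ball a δ, |s * F x - 1 / (2 * π) * pot logKernel μ x| ≤ R := by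
      intro x hx
      have hxc : x ∈ closedBall a δ := ball_subset_closedBall hx
      have hxK : x ∈ K := hbK _ hxc
      have hsplit : s * F x - 1 / (2 * π) * pot logKernel μ x =
          -pot h μ x + s * ((∑ i' ∈ Finset.univ.erase i, pot G (ωs i') x) +
            ∑ j, κ (Fin.natAdd p j) * G (z j) x) := by
        have e1 : pot G ω x = pot G (ωs i) x + ∑ i' ∈ Finset.univ.erase i, pot G (ωs i') x := by
          rw [hω, pot_sum _ hKm hGK (fun i _ => hbddK i) hxK,
            Finset.add_sum_erase _ (fun i' => pot G (ωs i') x) (Finset.mem_univ i)]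
        have e2 : s * pot G (ωs i) x = 1 / (2 * π) * pot logKernel μ x - pot h μ x := by
          rw [← pot_eq_sub hKm (integrableKernel_logKernel hK) hhK hG hμK hxK, hμ, pot_smul]
        simp only [hF, e1, mul_add, e2]
        ring
      have b1 : |pot h μ x| ≤ M * m := by
        rw [← habsμ]
        refine abs_pot_le (hμK.integrable hK) fun y hy => hMh x hxK y ?_
        exact by_contra fun hyK => hy (hμK.2.1 y hyK)
      have b2 : ∀ i' ∈ Finset.univ.erase i, |pot G (ωs i') x| ≤ M * |κ (Fin.castAdd l i')| := by
        intro i' hi'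
        rw [← hmass]
        refine abs_pot_le ((hbddK i').integrable hK) fun y hy => ?_
        have hyc : y ∈ closedBall (xb (Fin.castAdd l i')) δ :=
          by_contra fun hyc => hy ((hbdd i').2.1 y hyc)
        refine hMG x hxK y (hbK _ hyc) (hfar _ _ (fun heq => ?_) x hxc y hyc)
        exact (Finset.mem_erase.1 hi').1 (Fin.castAdd_injective p l heq).symm
      have b3 : ∀ j ∈ (Finset.univ : Finset (Fin l)), |κ (Fin.natAdd p j) * G (z j) x| ≤
          M * |κ (Fin.natAdd p j)| := by
        intro j hj
        rw [abs_mul, mul_comm]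
        refine mul_le_mul_of_nonneg_right ?_ (abs_nonneg _)
        refine hMG _ (hzK j hj) x hxK (hfar _ _ (fun heq => ?_) _ (hz j) x hxc)
        have := congrArg Fin.val heq
        simp only [Fin.val_natAdd, Fin.val_castAdd] at this
        omega
      have hs1 : |s| = 1 := by
        rcases sign_eq_one_or_neg_one (hκ (Fin.castAdd l i)) with h' | h' <;> simp [hs, h']
      rw [hsplit]
      calc |-pot h μ x + s * ((∑ i' ∈ Finset.univ.erase i, pot G (ωs i') x) +
            ∑ j, κ (Fin.natAdd p j) * G (z j) x)|
          ≤ |pot h μ x| + (∑ i' ∈ Finset.univ.erase i, |pot G (ωs i') x| +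
            ∑ j, |κ (Fin.natAdd p j) * G (z j) x|) := by
            refine (abs_add_le _ _).trans ?_
            rw [abs_neg, abs_mul, hs1, one_mul]
            exact add_le_add_right ((abs_add_le _ _).trans (add_le_add
              (Finset.abs_sum_le_sum_abs _ _) (Finset.abs_sum_le_sum_abs _ _))) _
        _ ≤ M * m + (∑ i' ∈ Finset.univ.erase i, M * |κ (Fin.castAdd l i')| +
            ∑ j, M * |κ (Fin.natAdd p j)|) :=
            add_le_add b1 (add_le_add (Finset.sum_le_sum b2) (Finset.sum_le_sum b3))
        _ = R := by
            rw [hRdef, Fin.sum_univ_add, ← add_assoc, hm,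
              Finset.add_sum_erase Finset.univ (fun i' => M * |κ (Fin.castAdd l i')|)
                (Finset.mem_univ i), mul_add, Finset.mul_sum, Finset.mul_sum]
    obtain ⟨c, hcub, hclb⟩ := exists_lower_bound_of_maximizer (a := a) (δ := δ) (m := m)
      (lam := lam) (ε := ε) (M := M) (R := R) (G := G) (h := h) (f := fun x => s * F x) (μ := μ)
      hG (integrableKernel_of_continuousOn (isCompact_closedBall a δ)
        (hcontK.mono (Set.prod_mono (hbK _) (hbK _))))
      (fun x hx y hy => hMh x (hbK _ hx) y (hbK _ hy)) hμK.1 hsupp h0 hle hmμ hm0 hε hεδ hlamε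
      ((hFint.mono_set (ball_subset_closedBall.trans (hbK _))).const_mul s) hfield (by
        intro η g1 g2 g3 g4 g5 t ht ht1
        have hηK : BddDensity K η := by
          refine ⟨g1, fun x hx => g2 x fun h' => hx (hbK _ (ball_subset_closedBall h')), lam, ?_⟩
          filter_upwards [g4, g5] with x hx hx'
          rwa [abs_of_nonneg hx]
        have hdiff : BddDensity K (η - μ) := by
          have := hηK.add (hμK.smul (-1))
          rwa [neg_one_smul, ← sub_eq_add_neg] at this
        have hθK : BddDensity K (s • (η - μ)) := hdiff.smul s
        have hnew : ωs i + t • s • (η - μ) = s • ((1 - t) • μ + t • η) := by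
          rw [hμω]
          module
        have hcomp : Adm δ lam (Function.update ωs i (ωs i + t • s • (η - μ))) := by
          rw [hAdm]
          intro i'
          by_cases hi' : i' = i
          · subst hi'
            rw [Function.update_self, hnew]
            have hsum : ∫ x, ((1 - t) • μ + t • η) x = m := by
              simp only [Pi.add_apply, Pi.smul_apply, smul_eq_mul]
              rw [integral_add ((hμK.integrable hK).const_mul _)
                ((hηK.integrable hK).const_mul _), integral_const_mul, integral_const_mul, hmμ, g3]
              ring
            have hcancel : ∀ x, s * (s • ((1 - t) • μ + t • η)) x = (1 - t) * μ x + t * η x := by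
              intro x
              simp only [Pi.add_apply, Pi.smul_apply, smul_eq_mul]
              rw [← mul_assoc, hs2, one_mul]
            have hzero : ∀ x, x ∉ ball a δ → (s • ((1 - t) • μ + t • η)) x = 0 := fun x hx => by
              simp [hsupp x hx, g2 x hx]
            refine ⟨((hμK.1.const_smul _).add (g1.const_smul _)).const_smul s, hzero, ?_, ?_⟩
            · rw [hint _ _ hzero]
              simp only [Pi.smul_apply s, smul_eq_mul]
              rw [integral_const_mul, hsum, ← hsκ, ← mul_assoc, hs2, one_mul]
            · filter_upwards [h0, hle, g4, g5] with x k1 k2 k3 k4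
              rw [hcancel]
              constructor
              · have := mul_nonneg (sub_nonneg.2 ht1) k1
                have := mul_nonneg ht.le k3
                linarith
              · have := mul_le_mul_of_nonneg_left k2 (sub_nonneg.2 ht1)
                have := mul_le_mul_of_nonneg_left k4 ht.le
                linarith
          · rw [Function.update_of_ne hi']
            exact hadm' i'
        have hsumnew : ∑ i', Function.update ωs i (ωs i + t • s • (η - μ)) i' =
            ω + t • s • (η - μ) := by
          rw [Finset.sum_update_of_mem (Finset.mem_univ i), hω,
            ← Finset.add_sum_erase _ ωs (Finset.mem_univ i), Finset.sdiff_singleton_eq_erase]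
          abel
        have hcmp := hmax _ z hcomp hz
        rw [hsumnew, hexpand _ hθK t, mutualEnergy_smul_left, mutualEnergy_smul_right,
          ← mul_assoc, hs2, one_mul] at hcmp
        have hlin : ∫ x, (η x - μ x) * (s * F x) = ∫ x, (s • (η - μ)) x * F x := by
          congr! 2 with x
          simp only [Pi.smul_apply, Pi.sub_apply, smul_eq_mul]
          ring
        rw [hlin]
        linarith)
    have hosc : ∀ x ∈ ball a δ, s * F x ≤ c + Δ i := fun x hx =>
      (hcub x hx).trans (by linarith [le_max_right 0 (oscillationBound m M R)])
    have hfin := integral_mul_sub_essInf_le measurableSet_ball hμK.1 (hμK.integrable hK) hsupp h0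
      hmμ hm0 (hΔ0 i) hosc hclb
    rw [hint (Fin.castAdd l i) _ fun x hx => by rw [h2 x hx, zero_mul], div_mul_eq_mul_div,
      ← integral_const_mul]
    simp only [← mul_assoc s (ωs i _)]
    have : ∀ e : ℝ, ∫ x, s * ωs i x * (s * F x - e) = ∫ x, μ x * (s * F x - e) := fun e => rfl
    rw [this]
    change (∫ x, μ x * (s * F x - essInf (fun x => s * F x)
      (volume.restrict {x ∈ ball a δ | 0 < μ x}))) / 2 ≤ _
    linarith
  simp only [hψpot hωK]
  exact (Finset.sum_le_sum fun i _ => hmain i).trans (by linarith)
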